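/- (Uniform convergence of the Kantorovich-type operator.) Let q and α be real numbers with 0 < q < 1 and α > 0, and let f : ℝ → ℝ be bounded, measurable, and uniformly continuous. Then sup_{x ∈ ℝ} |K_n(f; x) − f(x)| → 0 as n → ∞; that is, the Kantorovich operators K_n(f; ·) converge to f uniformly on ℝ. -/

import Mathlib

/-- The generalized hyperbolic tangent activation function. -/
noncomputable def h (q α x : ℝ) : ℝ :=
  (Real.exp (α * x) - q * Real.exp (-(α * x))) /
    ((1 + q) * Real.exp (α * x) + (1 - q) * Real.exp (-(α * x)))

/-- The associated density function. -/
noncomputable def ψ (q α x : ℝ) : ℝ :=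
  ((1 - q ^ 2) / (2 * (1 + q ^ 2))) * (h q α (x + 1) - h q α (x - 1))

/-- The quasi-interpolation neural network operator. -/
noncomputable def A (q α : ℝ) (n : ℕ) (f : ℝ → ℝ) (x : ℝ) : ℝ :=
  ∑' k : ℤ, f (k / n) * ψ q α (n * x - k)

/-- The Kantorovich-type neural network operator. -/
noncomputable def K (q α : ℝ) (n : ℕ) (f : ℝ → ℝ) (x : ℝ) : ℝ :=
  ∑' k : ℤ, ((n : ℝ) * ∫ t in ((k : ℝ) / n)..(((k : ℝ) + 1) / n), f t) * ψ q α (n * x - k)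

open Filter Topology

/-- The supremum of the increments of `f` over pairs of points at distance at most `δ`. -/
noncomputable def modulusOfContinuity (f : ℝ → ℝ) (δ : ℝ) : ℝ :=
  ⨆ p : {p : ℝ × ℝ // |p.1 - p.2| ≤ δ}, |f p.1.1 - f p.1.2|

section modulusOfContinuity

variable {f : ℝ → ℝ} {M : ℝ}

lemma abs_sub_le_of_bounded (hM : ∀ x, |f x| ≤ M) (s t : ℝ) : |f s - f t| ≤ 2 * M := by
  linarith [abs_sub (f s) (f t), hM s, hM t]

lemma abs_sub_le_modulusOfContinuity (hM : ∀ x, |f x| ≤ M) {s t δ : ℝ} (hst : |s - t| ≤ δ) :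
    |f s - f t| ≤ modulusOfContinuity f δ := by
  refine le_ciSup (f := fun p : {p : ℝ × ℝ // |p.1 - p.2| ≤ δ} => |f p.1.1 - f p.1.2|)
    ?_ ⟨(s, t), hst⟩
  refine ⟨2 * M, ?_⟩
  rintro _ ⟨p, rfl⟩
  exact abs_sub_le_of_bounded hM _ _

lemma modulusOfContinuity_nonneg (f : ℝ → ℝ) (δ : ℝ) : 0 ≤ modulusOfContinuity f δ :=
  Real.iSup_nonneg fun _ => abs_nonneg _

lemma modulusOfContinuity_le_of_bounded (hM : ∀ x, |f x| ≤ M) (δ : ℝ) :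
    modulusOfContinuity f δ ≤ 2 * M :=
  Real.iSup_le (fun _ => abs_sub_le_of_bounded hM _ _)
    (by linarith [abs_nonneg (f 0), hM 0])

lemma UniformContinuous.tendsto_modulusOfContinuity (hf : UniformContinuous f) :
    Tendsto (modulusOfContinuity f) (𝓝 0) (𝓝 0) := by
  rw [Metric.tendsto_nhds_nhds]
  intro ε hε
  obtain ⟨δ, hδ, hfδ⟩ := Metric.uniformContinuous_iff.1 hf (ε / 2) (by positivity)
  refine ⟨δ, hδ, fun {η} hη => ?_⟩
  rw [Real.dist_eq, sub_zero] at hη ⊢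
  rw [abs_of_nonneg (modulusOfContinuity_nonneg f η)]
  refine lt_of_le_of_lt (Real.iSup_le (fun p => ?_) (by positivity)) (half_lt_self hε)
  exact (hfδ (lt_of_le_of_lt p.2 (lt_of_le_of_lt (le_abs_self η) hη))).le

end modulusOfContinuity

/-- Telescoping over `ℤ` for a monotone function with limits at both ends. -/
lemma Monotone.hasSum_int_sub {F : ℝ → ℝ} (hF : Monotone F) {a b : ℝ}
    (ha : Tendsto F atBot (𝓝 a)) (hb : Tendsto F atTop (𝓝 b)) (y : ℝ) :
    HasSum (fun k : ℤ => F (y - k + 1) - F (y - k)) (b - a) := by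
  have hpos : HasSum (fun n : ℕ => F (y - (n : ℤ) + 1) - F (y - (n : ℤ))) (F (y + 1) - a) := by
    rw [hasSum_iff_tendsto_nat_of_nonneg fun n => sub_nonneg.2 (hF (by linarith))]
    have hsum : ∀ n : ℕ, ∑ i ∈ Finset.range n, (F (y - (i : ℤ) + 1) - F (y - (i : ℤ)))
        = F (y + 1) - F (y + 1 - n) := by
      intro n
      have := Finset.sum_range_sub' (fun i : ℕ => F (y + 1 - i)) n
      simp only [Nat.cast_zero, sub_zero] at this
      rw [← this]
      refine Finset.sum_congr rfl fun i _ => ?_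
      push_cast
      congr 2 <;> ring
    simp only [hsum]
    refine tendsto_const_nhds.sub (ha.comp ?_)
    exact tendsto_atBot_add_const_left _ _
      (tendsto_neg_atTop_atBot.comp tendsto_natCast_atTop_atTop)
  have hneg : HasSum (fun n : ℕ => F (y - (-((n : ℤ) + 1) : ℤ) + 1) - F (y - (-((n : ℤ) + 1) : ℤ)))
      (b - F (y + 1)) := by
    rw [hasSum_iff_tendsto_nat_of_nonneg fun n => sub_nonneg.2 (hF (by linarith))]
    have hsum : ∀ n : ℕ, ∑ i ∈ Finset.range n,
        (F (y - (-((i : ℤ) + 1) : ℤ) + 1) - F (y - (-((i : ℤ) + 1) : ℤ)))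
        = F (y + 1 + n) - F (y + 1) := by
      intro n
      have := Finset.sum_range_sub (fun i : ℕ => F (y + 1 + i)) n
      simp only [Nat.cast_zero, add_zero] at this
      rw [← this]
      refine Finset.sum_congr rfl fun i _ => ?_
      push_cast
      congr 2 <;> ring
    simp only [hsum]
    refine (hb.comp ?_).sub tendsto_const_nhds
    exact tendsto_atTop_add_const_left _ _ tendsto_natCast_atTop_atTop
  have hsum := HasSum.of_nat_of_neg_add_one
    (f := fun k : ℤ => F (y - k + 1) - F (y - k)) hpos hneg
  rwa [sub_add_sub_comm, add_comm a, ← sub_sub, add_sub_cancel_left] at hsum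

section density

variable {q α : ℝ}

lemma h_eq_sub_div (hq0 : 0 < q) (hq1 : q < 1) (x : ℝ) :
    h q α x = 1 / (1 + q) -
      ((1 + q ^ 2) / (1 + q)) / ((1 + q) * Real.exp (2 * α * x) + (1 - q)) := by
  have he : Real.exp (2 * α * x) = Real.exp (α * x) * Real.exp (α * x) := by
    rw [← Real.exp_add]; ring_nf
  have hp : 0 < Real.exp (α * x) := Real.exp_pos _
  have hq : 0 < 1 - q := sub_pos.2 hq1
  rw [h, he, Real.exp_neg]
  have hD : (1 + q) * Real.exp (α * x) ^ 2 + (1 - q) ≠ 0 := by positivity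
  have hn : Real.exp (α * x) - q * (Real.exp (α * x))⁻¹ =
      (Real.exp (α * x) ^ 2 - q) / Real.exp (α * x) := by field_simp
  have hd : (1 + q) * Real.exp (α * x) + (1 - q) * (Real.exp (α * x))⁻¹ =
      ((1 + q) * Real.exp (α * x) ^ 2 + (1 - q)) / Real.exp (α * x) := by field_simp
  rw [hn, hd, div_div_div_cancel_right₀ hp.ne', ← pow_two, div_div,
    div_sub_div _ _ (by positivity) (by positivity), div_eq_div_iff hD (by positivity)]
  ring

lemma monotone_h (hq0 : 0 < q) (hq1 : q < 1) (hα : 0 < α) : Monotone (h q α) := by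
  intro x y hxy
  have hq : 0 < 1 - q := sub_pos.2 hq1
  rw [h_eq_sub_div hq0 hq1, h_eq_sub_div hq0 hq1]
  gcongr

lemma tendsto_h_atTop (hq0 : 0 < q) (hq1 : q < 1) (hα : 0 < α) :
    Tendsto (h q α) atTop (𝓝 (1 / (1 + q))) := by
  rw [funext (h_eq_sub_div (α := α) hq0 hq1)]
  have hE : Tendsto (fun x => (1 + q) * Real.exp (2 * α * x) + (1 - q)) atTop atTop :=
    tendsto_atTop_add_const_right _ _ ((Real.tendsto_exp_atTop.comp
      (tendsto_id.const_mul_atTop (by positivity : 0 < 2 * α))).const_mul_atTop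
        (by positivity : 0 < 1 + q))
  simpa using (tendsto_const_nhds (x := 1 / (1 + q))).sub
    (hE.const_div_atTop ((1 + q ^ 2) / (1 + q)))

lemma tendsto_h_atBot (hq0 : 0 < q) (hq1 : q < 1) (hα : 0 < α) :
    Tendsto (h q α) atBot (𝓝 (1 / (1 + q) - (1 + q ^ 2) / (1 + q) / (1 - q))) := by
  rw [funext (h_eq_sub_div (α := α) hq0 hq1)]
  have hE : Tendsto (fun x => (1 + q) * Real.exp (2 * α * x) + (1 - q)) atBot (𝓝 (1 - q)) := by
    have := ((Real.tendsto_exp_atBot.comp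
      (tendsto_id.const_mul_atBot (by positivity : 0 < 2 * α))).const_mul (1 + q)).add_const (1 - q)
    simpa using this
  exact tendsto_const_nhds.sub (tendsto_const_nhds.div hE (sub_pos.2 hq1).ne')

lemma hasSum_h_sub (hq0 : 0 < q) (hq1 : q < 1) (hα : 0 < α) (y : ℝ) :
    HasSum (fun k : ℤ => h q α (y - k + 1) - h q α (y - k))
      ((1 + q ^ 2) / (1 + q) / (1 - q)) := by
  simpa using (monotone_h hq0 hq1 hα).hasSum_int_sub (tendsto_h_atBot hq0 hq1 hα)
    (tendsto_h_atTop hq0 hq1 hα) y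

lemma ψ_nonneg (hq0 : 0 < q) (hq1 : q < 1) (hα : 0 < α) (x : ℝ) : 0 ≤ ψ q α x := by
  have : 0 ≤ 1 - q ^ 2 := by nlinarith
  exact mul_nonneg (by positivity) (sub_nonneg.2 (monotone_h hq0 hq1 hα (by linarith)))

lemma hasSum_ψ (hq0 : 0 < q) (hq1 : q < 1) (hα : 0 < α) (y : ℝ) :
    HasSum (fun k : ℤ => ψ q α (y - k)) 1 := by
  have hq : 1 - q ≠ 0 := (sub_pos.2 hq1).ne'
  have hone : (1 - q ^ 2) / (2 * (1 + q ^ 2)) *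
      ((1 + q ^ 2) / (1 + q) / (1 - q) + (1 + q ^ 2) / (1 + q) / (1 - q)) = 1 := by
    field_simp
    ring
  rw [← hone]
  refine (congrArg (HasSum · _) (funext fun k => ?_)).mpr
    (((hasSum_h_sub hq0 hq1 hα y).add (hasSum_h_sub hq0 hq1 hα (y - 1))).mul_left
      ((1 - q ^ 2) / (2 * (1 + q ^ 2))))
  rw [ψ, show y - 1 - (k : ℝ) + 1 = y - k by ring, show y - 1 - (k : ℝ) = y - k - 1 by ring]
  ring

/-- A bound for `ψ q α (r - j)` that is uniform in `r ∈ [0, 1]`. -/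
noncomputable def ψMajorant (q α : ℝ) (j : ℤ) : ℝ :=
  ((1 - q ^ 2) / (2 * (1 + q ^ 2))) * (h q α (2 - j) - h q α (-1 - j))

lemma ψ_le_ψMajorant (hq0 : 0 < q) (hq1 : q < 1) (hα : 0 < α) {r : ℝ} (hr0 : 0 ≤ r)
    (hr1 : r ≤ 1) (j : ℤ) : ψ q α (r - j) ≤ ψMajorant q α j := by
  have : 0 ≤ 1 - q ^ 2 := by nlinarith
  refine mul_le_mul_of_nonneg_left (sub_le_sub ?_ ?_) (by positivity) <;>
    exact monotone_h hq0 hq1 hα (by linarith)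

lemma summable_ψMajorant (hq0 : 0 < q) (hq1 : q < 1) (hα : 0 < α) :
    Summable (ψMajorant q α) := by
  refine (summable_congr fun j => ?_).2 ((((hasSum_h_sub hq0 hq1 hα 1).add
    (hasSum_h_sub hq0 hq1 hα 0)).add (hasSum_h_sub hq0 hq1 hα (-1))).summable.mul_left
      ((1 - q ^ 2) / (2 * (1 + q ^ 2))))
  rw [ψMajorant, show (1 : ℝ) - j + 1 = 2 - j by ring, show (0 : ℝ) - j + 1 = 1 - j by ring,
    show (-1 : ℝ) - j + 1 = 0 - j by ring]
  ring

end density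

lemma abs_average_sub_le {f : ℝ → ℝ} (hf : Continuous f) {n : ℕ} (hn : 0 < n) (k : ℤ) {x C : ℝ}
    (hC : ∀ t : ℝ, (k : ℝ) / n ≤ t → t ≤ ((k : ℝ) + 1) / n → |f t - f x| ≤ C) :
    |(n : ℝ) * (∫ t in ((k : ℝ) / n)..(((k : ℝ) + 1) / n), f t) - f x| ≤ C := by
  have hn' : (0 : ℝ) < n := Nat.cast_pos.2 hn
  have hlen : ((k : ℝ) + 1) / n - (k : ℝ) / n = 1 / n := by ring
  have hle : (k : ℝ) / n ≤ ((k : ℝ) + 1) / n := by gcongr; linarith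
  have hbound := intervalIntegral.norm_integral_le_of_norm_le_const
    (a := (k : ℝ) / n) (b := ((k : ℝ) + 1) / n) (f := fun t => f t - f x) (C := C) fun t ht => by
      rw [Set.uIoc_of_le hle] at ht
      exact hC t ht.1.le ht.2
  rw [intervalIntegral.integral_sub (hf.intervalIntegrable _ _) intervalIntegrable_const,
    intervalIntegral.integral_const, hlen, Real.norm_eq_abs, smul_eq_mul,
    abs_of_pos (one_div_pos.2 hn')] at hbound
  calc _ = n * |(∫ t in ((k : ℝ) / n)..(((k : ℝ) + 1) / n), f t) - 1 / n * f x| := by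
        rw [← abs_of_pos (a := (n : ℝ)) hn', ← abs_mul, abs_of_pos hn', mul_sub, ← mul_assoc,
          mul_one_div_cancel hn'.ne', one_mul]
    _ ≤ n * (C * (1 / n)) := by gcongr
    _ = C := by field_simp

lemma abs_K_sub_le {q α : ℝ} (hq0 : 0 < q) (hq1 : q < 1) (hα : 0 < α) {f : ℝ → ℝ}
    (hf : Continuous f) {M : ℝ} (hM : ∀ x, |f x| ≤ M) {n : ℕ} (hn : 0 < n) (x : ℝ) :
    |K q α n f x - f x| ≤
      ∑' j : ℤ, modulusOfContinuity f ((|(j : ℝ)| + 1) / n) * ψMajorant q α j := by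
  have hn' : (0 : ℝ) < n := Nat.cast_pos.2 hn
  set m : ℤ := ⌊(n : ℝ) * x⌋
  set r : ℝ := Int.fract ((n : ℝ) * x)
  have hr0 : 0 ≤ r := Int.fract_nonneg _
  have hr1 : r ≤ 1 := (Int.fract_lt_one _).le
  have hmr : (m : ℝ) + r = n * x := Int.floor_add_fract _
  set a : ℤ → ℝ := fun k => (n : ℝ) * ∫ t in ((k : ℝ) / n)..(((k : ℝ) + 1) / n), f t
  have ha : ∀ j : ℤ, |a (j + m) - f x| ≤ modulusOfContinuity f ((|(j : ℝ)| + 1) / n) := by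
    intro j
    refine abs_average_sub_le hf hn _ fun t ht₁ ht₂ => abs_sub_le_modulusOfContinuity hM ?_
    rw [div_le_iff₀ hn'] at ht₁
    rw [le_div_iff₀ hn'] at ht₂
    push_cast at ht₁ ht₂
    rw [le_div_iff₀ hn', show |t - x| * n = |(t - x) * n| by rw [abs_mul, abs_of_pos hn'], abs_le]
    constructor <;> nlinarith [neg_abs_le (j : ℝ), le_abs_self (j : ℝ)]
  have hterm : ∀ j : ℤ, ‖(a (j + m) - f x) * ψ q α (r - j)‖ ≤
      modulusOfContinuity f ((|(j : ℝ)| + 1) / n) * ψMajorant q α j := by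
    intro j
    rw [norm_mul, Real.norm_eq_abs, Real.norm_eq_abs, abs_of_nonneg (ψ_nonneg hq0 hq1 hα _)]
    exact mul_le_mul (ha j) (ψ_le_ψMajorant hq0 hq1 hα hr0 hr1 j) (ψ_nonneg hq0 hq1 hα _)
      (modulusOfContinuity_nonneg f _)
  have hg : ∀ j, 0 ≤ ψMajorant q α j := fun j =>
    (ψ_nonneg hq0 hq1 hα _).trans (ψ_le_ψMajorant hq0 hq1 hα hr0 hr1 j)
  have hsum : Summable fun j : ℤ =>
      modulusOfContinuity f ((|(j : ℝ)| + 1) / n) * ψMajorant q α j :=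
    Summable.of_nonneg_of_le (fun j => mul_nonneg (modulusOfContinuity_nonneg f _) (hg j))
      (fun j => mul_le_mul_of_nonneg_right (modulusOfContinuity_le_of_bounded hM _) (hg j))
      ((summable_ψMajorant hq0 hq1 hα).mul_left (2 * M))
  have hK : K q α n f x = ∑' j : ℤ, a (j + m) * ψ q α (r - j) := by
    rw [K, ← (Equiv.addRight m).tsum_eq]
    refine tsum_congr fun j => ?_
    rw [Equiv.coe_addRight, show r - (j : ℝ) = n * x - ((j + m : ℤ) : ℝ) by
      push_cast; linarith]
  have hdiff := ((hsum.of_norm_bounded hterm).hasSum.add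
    ((hasSum_ψ hq0 hq1 hα r).mul_left (f x))).tsum_eq
  have hKsub : K q α n f x - f x = ∑' j : ℤ, (a (j + m) - f x) * ψ q α (r - j) := by
    rw [hK, sub_eq_iff_eq_add]
    simpa [← add_mul] using hdiff
  rw [hKsub]
  exact tsum_of_norm_bounded hsum.hasSum hterm

theorem kantorovich_uniform_convergence (q α : ℝ) (hq0 : 0 < q) (hq1 : q < 1)
    (hα : 0 < α) (f : ℝ → ℝ) (hbd : ∃ M : ℝ, ∀ x : ℝ, |f x| ≤ M)
    (hmeas : Measurable f) (hf : UniformContinuous f) :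
    Filter.Tendsto (fun n : ℕ => ⨆ x : ℝ, |K q α n f x - f x|) Filter.atTop (nhds 0) := by
  obtain ⟨M, hM⟩ := hbd
  have hg : ∀ j, 0 ≤ ψMajorant q α j := fun j =>
    (ψ_nonneg hq0 hq1 hα _).trans (ψ_le_ψMajorant hq0 hq1 hα le_rfl zero_le_one j)
  have hlim : Tendsto (fun n : ℕ =>
      ∑' j : ℤ, modulusOfContinuity f ((|(j : ℝ)| + 1) / n) * ψMajorant q α j) atTop (𝓝 0) := by
    rw [← tsum_zero (α := ℝ) (β := ℤ)]
    refine tendsto_tsum_of_dominated_convergence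
      ((summable_ψMajorant hq0 hq1 hα).mul_left (2 * M)) (fun j => ?_)
      (Eventually.of_forall fun n j => ?_)
    · simpa using (hf.tendsto_modulusOfContinuity.comp
        (tendsto_const_div_atTop_nhds_zero_nat (|(j : ℝ)| + 1))).mul_const (ψMajorant q α j)
    · rw [Real.norm_eq_abs, abs_of_nonneg (mul_nonneg (modulusOfContinuity_nonneg f _) (hg j))]
      exact mul_le_mul_of_nonneg_right (modulusOfContinuity_le_of_bounded hM _) (hg j)
  refine squeeze_zero' (Eventually.of_forall fun n => Real.iSup_nonneg fun _ => abs_nonneg _)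
    ?_ hlim
  filter_upwards [eventually_gt_atTop 0] with n hn
  exact ciSup_le fun x => abs_K_sub_le hq0 hq1 hα hf.continuous hM hn x
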